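/- Let M be a symmetric MDS matrix of odd order n over F_{2^m}. Then M admits a nontrivial pair of related differentials. In particular, there exist nonzero vectors u supported on coordinates {1,…,(n+1)/2} and v supported on coordinates {(n+1)/2,…,n} such that Mu is supported on {1,…,(n+1)/2}, Mv is supported on {(n+1)/2,…,n}, and (Mu)_{(n+1)/2} = (Mv)_{(n+1)/2}. -/

import Mathlib

/-- `u` and `v` are related differences. -/
def RelDiff {n : ℕ} {F : Type*} [Field F] (u v : Fin n → F) : Prop :=
  ∀ i, u i * v i * (u i + v i) = 0

/-- A square matrix is MDS iff every square submatrix is nonsingular. -/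
def IsMDS {n : ℕ} {F : Type*} [Field F] (M : Matrix (Fin n) (Fin n) F) : Prop :=
  ∀ (k : ℕ) (r c : Fin k → Fin n), Function.Injective r → Function.Injective c →
    (M.submatrix r c).det ≠ 0

lemma exists_vec {n k : ℕ} {F : Type*} [Field F] (M : Matrix (Fin n) (Fin n) F)
    (hM : IsMDS M) (r c : Fin k → Fin n) (hr : Function.Injective r)
    (hc : Function.Injective c) (p : Fin n) (hp : ∀ j, c j ≠ p) :
    ∃ u : Fin n → F, u p = 1 ∧ (∀ i, u i ≠ 0 → i = p ∨ ∃ j, c j = i) ∧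
      ∀ j, M.mulVec u (r j) = 0 := by
  have hdet : IsUnit (M.submatrix r c).det := isUnit_iff_ne_zero.mpr (hM k r c hr hc)
  obtain ⟨x, hx⟩ : ∃ x : Fin k → F, (M.submatrix r c).mulVec x = fun j => - M (r j) p := by
    refine ⟨(M.submatrix r c)⁻¹.mulVec (fun j => - M (r j) p), ?_⟩
    rw [Matrix.mulVec_mulVec, Matrix.mul_nonsing_inv _ hdet, Matrix.one_mulVec]
  refine ⟨Pi.single p 1 + ∑ j, x j • Pi.single (c j) 1, ?_, ?_, ?_⟩
  · have : ∀ j, (Pi.single (c j) (1 : F) : Fin n → F) p = 0 := fun j =>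
      Pi.single_eq_of_ne (hp j).symm _
    simp [this]
  · intro i hi
    by_contra hcon
    push Not at hcon
    apply hi
    have h2 : ∀ j, (Pi.single (c j) (1 : F) : Fin n → F) i = 0 := fun j =>
      Pi.single_eq_of_ne (hcon.2 j).symm _
    have h1 : (Pi.single p (1 : F) : Fin n → F) i = 0 := Pi.single_eq_of_ne hcon.1 _
    simp [h1, h2]
  · intro j
    have h := congrFun hx j
    rw [Matrix.mulVec_add, Matrix.mulVec_sum]
    simp only [Matrix.mulVec_smul, Matrix.mulVec_single_one, Pi.add_apply, Finset.sum_apply,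
      Pi.smul_apply, Matrix.col_apply, smul_eq_mul]
    simp only [Matrix.mulVec, dotProduct, Matrix.submatrix_apply] at h
    have : ∑ i, x i * M (r j) (c i) = - M (r j) p := by
      rw [← h]; exact Finset.sum_congr rfl fun _ _ => mul_comm _ _
    rw [this]; ring

/-- Every symmetric MDS matrix of odd order admits a nontrivial pair of related
differentials; in particular one with `u` supported on the first `(n+1)/2` coordinates,
`v` supported on the last `(n+1)/2` coordinates (0-based indices `≥ (n-1)/2`), with
`Mu`, `Mv` supported likewise and agreeing at the middle coordinate. -/
theorem stmt8 (m n : ℕ) (hn : Odd n) (hpos : 0 < n)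
    (M : Matrix (Fin n) (Fin n) (GaloisField 2 m))
    (hsym : M.IsSymm) (hMDS : IsMDS M) :
    ∃ u v : Fin n → GaloisField 2 m, u ≠ 0 ∧ v ≠ 0 ∧
      (∀ i : Fin n, u i ≠ 0 → i.val < (n + 1) / 2) ∧
      (∀ i : Fin n, v i ≠ 0 → (n - 1) / 2 ≤ i.val) ∧
      (∀ i : Fin n, M.mulVec u i ≠ 0 → i.val < (n + 1) / 2) ∧
      (∀ i : Fin n, M.mulVec v i ≠ 0 → (n - 1) / 2 ≤ i.val) ∧
      M.mulVec u ⟨(n - 1) / 2, by omega⟩ = M.mulVec v ⟨(n - 1) / 2, by omega⟩ ∧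
      RelDiff u v ∧ RelDiff (M.mulVec u) (M.mulVec v) := by
  obtain ⟨k, rfl⟩ := hn
  have e1 : (2 * k + 1 + 1) / 2 = k + 1 := by omega
  have e2 : (2 * k + 1 - 1) / 2 = k := by omega
  simp only [e1, e2]
  let lo : Fin k → Fin (2 * k + 1) := fun j => ⟨j.val, by omega⟩
  let hi : Fin k → Fin (2 * k + 1) := fun j => ⟨j.val + k + 1, by omega⟩
  have hlo : Function.Injective lo := fun a b h => by
    have := congrArg Fin.val h; simp only [lo] at this; exact Fin.ext this
  have hhi : Function.Injective hi := fun a b h => by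
    have := congrArg Fin.val h; simp only [hi] at this; exact Fin.ext (by omega)
  let p : Fin (2 * k + 1) := ⟨k, by omega⟩
  obtain ⟨u, up, us, uz⟩ := exists_vec M hMDS hi lo hhi hlo p
    (fun j h => by have := congrArg Fin.val h; simp only [lo, p] at this; omega)
  obtain ⟨v, vp, vs, vz⟩ := exists_vec M hMDS lo hi hlo hhi p
    (fun j h => by have := congrArg Fin.val h; simp only [hi, p] at this; omega)
  have Su : ∀ i : Fin (2 * k + 1), u i ≠ 0 → i.val < k + 1 := by
    intro i h
    rcases us i h with rfl | ⟨j, rfl⟩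
    · simp [p]
    · simp only [lo]; omega
  have Sv : ∀ i : Fin (2 * k + 1), v i ≠ 0 → k ≤ i.val := by
    intro i h
    rcases vs i h with rfl | ⟨j, rfl⟩
    · simp [p]
    · simp only [hi]; omega
  have Mu : ∀ i : Fin (2 * k + 1), M.mulVec u i ≠ 0 → i.val < k + 1 := by
    intro i h
    by_contra hc
    apply h
    have := uz ⟨i.val - k - 1, by omega⟩
    have e : hi ⟨i.val - k - 1, by omega⟩ = i := Fin.ext (by simp only [hi]; omega)
    rwa [e] at this
  have Mv : ∀ i : Fin (2 * k + 1), M.mulVec v i ≠ 0 → k ≤ i.val := by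
    intro i h
    by_contra hc
    apply h
    exact vz ⟨i.val, by omega⟩
  have dis : ∀ a b : Fin (2 * k + 1) → GaloisField 2 m,
      (∀ i, a i ≠ 0 → i.val < k + 1) → (∀ i, b i ≠ 0 → k ≤ i.val) →
      ∀ i, i ≠ p → a i * b i = 0 := by
    intro a b ha hb i hip
    by_contra hne
    have h1 := ha i (left_ne_zero_of_mul hne)
    have h2 := hb i (right_ne_zero_of_mul hne)
    exact hip (Fin.ext (by simp only [p]; omega))
  have key : M.mulVec u p = M.mulVec v p := by
    have h1 : M.mulVec u ⬝ᵥ v = M.mulVec u p := by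
      rw [dotProduct, Finset.sum_eq_single p (fun i _ hip => dis _ _ Mu Sv i hip) (by simp),
        vp, mul_one]
    have h2 : u ⬝ᵥ M.mulVec v = M.mulVec v p := by
      rw [dotProduct, Finset.sum_eq_single p (fun i _ hip => dis _ _ Su Mv i hip) (by simp),
        up, one_mul]
    rw [← h1, ← h2, Matrix.dotProduct_mulVec, ← Matrix.mulVec_transpose, hsym.eq]
  have rel : ∀ a b : Fin (2 * k + 1) → GaloisField 2 m,
      (∀ i, a i ≠ 0 → i.val < k + 1) → (∀ i, b i ≠ 0 → k ≤ i.val) → a p = b p →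
      RelDiff a b := by
    intro a b ha hb hab i
    by_cases hip : i = p
    · subst hip
      rw [hab, CharTwo.add_self_eq_zero, mul_zero]
    · rw [dis a b ha hb i hip, zero_mul]
  refine ⟨u, v, ?_, ?_, Su, Sv, Mu, Mv, key, rel u v Su Sv (up.trans vp.symm), rel _ _ Mu Mv key⟩
  · rintro rfl
    simp at up
  · rintro rfl
    simp at vp
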